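/- Let q ≥ 2, C ≥ 1, let d ≥ 3 be an integer, let α, ε ∈ (0,1], let L ≥ 1, and set Π := 2^113 · q^10 · C^2 · d^24 · L^8 / (α^14 · ε^18). Let G be a d-regular simple graph on [n] that satisfies the long-range expansion property Expan(α,ε,L), let k ≥ 1, and let ‖·‖_X be a 1-unconditional norm on ℝ^k that has cotype q with constant C. If f : [n] → ℝ^k is any non-constant map with min{|{v ∈ [n] : f(v)_j ≥ 0}|, |{v ∈ [n] : f(v)_j ≤ 0}|} ≥ n/2 for every j ∈ [k], then ∑_{v∈[n]} ‖f(v)‖_X ≤ (3Π/2) · ∑_{{w,w'}∈E_G} ‖f(w)−f(w')‖_X. -/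

import Mathlib

open Finset

attribute [local instance] Classical.propDecidable

noncomputable section

/-- Distance (in `ℕ∞`) from a vertex to a finite set of vertices. -/
def vertexSetDist {n : ℕ} (G : SimpleGraph (Fin n)) (v : Fin n) (S : Finset (Fin n)) : ℕ∞ :=
  S.inf fun w => G.edist v w

/-- Distance (in `ℕ∞`) from a vertex to an (unordered) edge. -/
def edgeDist {n : ℕ} (G : SimpleGraph (Fin n)) (v : Fin n) (e : Sym2 (Fin n)) : ℕ∞ :=
  Sym2.lift ⟨fun a b => min (G.edist v a) (G.edist v b), fun _ _ => min_comm _ _⟩ e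

/-- Distance (in `ℕ∞`) from an (unordered) edge to a finite set of vertices. -/
def edgeSetDist {n : ℕ} (G : SimpleGraph (Fin n)) (e : Sym2 (Fin n)) (S : Finset (Fin n)) : ℕ∞ :=
  S.inf fun v => edgeDist G v e

/-- Part (A) of the long-range expansion property. -/
def ExpanA (n d : ℕ) (G : SimpleGraph (Fin n)) (α : ℝ) : Prop :=
  ∀ S : Finset (Fin n), S.Nonempty → ∀ ℓ : ℕ, 1 ≤ ℓ →
    min (3 * (n : ℝ) / 4) (α * ((d : ℝ) - 1) ^ ℓ * S.card) ≤
      ((univ.filter fun v => vertexSetDist G v S ≤ (ℓ : ℕ∞)).card : ℝ)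

/-- Part (B) of the long-range expansion property. -/
def ExpanB (n d : ℕ) (G : SimpleGraph (Fin n)) [DecidableRel G.Adj] (α ε L : ℝ) : Prop :=
  ∀ S : Finset (Fin n), S.Nonempty → ∀ ℓ : ℕ, 1 ≤ ℓ →
    α * ((d : ℝ) - 1) ^ (ℓ - 1) * S.card ≤ 3 * n / 4 →
    ∃ v ∈ S,
      (((G.edgeFinset.filter fun e =>
            L * ((d : ℝ) - 1 - ε) ^ ℓ ≤
              ((S.filter fun u => edgeDist G u e ≤ ((ℓ - 1 : ℕ) : ℕ∞)).card : ℝ)).filter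
          fun e => edgeDist G v e ≤ ((ℓ - 1 : ℕ) : ℕ∞)).card : ℝ) ≤
        L * ((d : ℝ) - 1 - ε) ^ ℓ

/-- The long-range expansion property `Expan(α, ε, L)`. -/
def Expan (n d : ℕ) (G : SimpleGraph (Fin n)) [DecidableRel G.Adj] (α ε L : ℝ) : Prop :=
  ExpanA n d G α ∧ ExpanB n d G α ε L

/-- `N` is a norm on `ℝ^k`. -/
def IsNorm (k : ℕ) (N : (Fin k → ℝ) → ℝ) : Prop :=
  (∀ x, N x = 0 ↔ x = 0) ∧ (∀ (c : ℝ) (x), N (c • x) = |c| * N x) ∧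
    ∀ x y, N (x + y) ≤ N x + N y

/-- The standard basis of `ℝ^k` is `K`-unconditional for `N`. -/
def UncondConst (k : ℕ) (N : (Fin k → ℝ) → ℝ) (K : ℝ) : Prop :=
  ∀ (σ : Fin k → Bool) (a : Fin k → ℝ),
    N (fun j => (if σ j then (1 : ℝ) else -1) * a j) ≤ K * N a

/-- `N` is a `1`-unconditional norm on `ℝ^k`: `‖y‖ = ‖|y|‖`. -/
def OneUnconditional (k : ℕ) (N : (Fin k → ℝ) → ℝ) : Prop :=
  ∀ y, N y = N fun j => |y j|

/-- `N` has cotype `q` with constant `C`. -/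
def HasCotype (k : ℕ) (N : (Fin k → ℝ) → ℝ) (q C : ℝ) : Prop :=
  ∀ (m : ℕ) (x : Fin m → Fin k → ℝ),
    1 / C ^ q * ∑ i, N (x i) ^ q ≤
      1 / 2 ^ m * ∑ σ : Fin m → Bool, N (∑ i, (if σ i then (1 : ℝ) else -1) • x i) ^ q

/-- The collection of vectors `Y` has restricted cotype `q` with constant `C` w.r.t. `N`. -/
def RestrictedCotype (k : ℕ) (N : (Fin k → ℝ) → ℝ) (q C : ℝ) (Y : Set (Fin k → ℝ)) : Prop :=
  ∀ (m : ℕ), 0 < m → ∀ y : Fin m → Fin k → ℝ, Function.Injective y → (∀ i, y i ∈ Y) →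
    1 / C ^ q * ∑ i, N (y i) ^ q ≤
      1 / 2 ^ m * ∑ σ : Fin m → Bool, N (∑ i, (if σ i then (1 : ℝ) else -1) • y i) ^ q

/-- For an edge `e = {a, b}`, the value `N (f a - f b)` (well-defined when `N` is a norm). -/
def edgeNorm {n k : ℕ} (N : (Fin k → ℝ) → ℝ) (f : Fin n → Fin k → ℝ) (e : Sym2 (Fin n)) : ℝ :=
  Sym2.lift ⟨fun a b => min (N (f a - f b)) (N (f b - f a)), fun _ _ => min_comm _ _⟩ e

/-- Coordinate projection `P_J`. -/
def proj {k : ℕ} (J : Finset (Fin k)) (y : Fin k → ℝ) : Fin k → ℝ :=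
  fun j => if j ∈ J then y j else 0

/-- Indicator vector `χ_J ∈ ℝ^k`. -/
def chi {k : ℕ} (J : Finset (Fin k)) : Fin k → ℝ := fun j => if j ∈ J then 1 else 0

/-- The sequence `a_ℓ = (6/π²) ℓ⁻²`. -/
def aseq (ℓ : ℕ) : ℝ := 6 / Real.pi ^ 2 * (1 / (ℓ : ℝ) ^ 2)

/-- The set of edges `E(S, j; ℓ)`: edges within distance `ℓ - 1` of `S` with a jump in the
`j`-th coordinate. -/
def jumpEdges {n k : ℕ} (G : SimpleGraph (Fin n)) [DecidableRel G.Adj]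
    (f : Fin n → Fin k → ℝ) (j : Fin k) (S : Finset (Fin n)) (ℓ : ℕ) :
    Finset (Sym2 (Fin n)) :=
  G.edgeFinset.filter fun e =>
    edgeSetDist G e S ≤ ((ℓ - 1 : ℕ) : ℕ∞) ∧
      Sym2.lift ⟨fun a b => f a j ≠ f b j, fun _ _ => propext ne_comm⟩ e

/-- The scale `ℓ_{v,j}`. -/
def lvj {n k : ℕ} (G : SimpleGraph (Fin n)) [DecidableRel G.Adj]
    (f : Fin n → Fin k → ℝ) (α : ℝ) (d : ℕ) (v : Fin n) (j : Fin k) : ℕ :=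
  sInf {ℓ : ℕ | 1 ≤ ℓ ∧
    α * aseq ℓ / 6 * ((d : ℝ) - 1) ^ (ℓ - 1) ≤ ((jumpEdges G f j {v} ℓ).card : ℝ)}

/-- The set `V_+(j; ℓ)`. -/
def Vplus {n k : ℕ} (G : SimpleGraph (Fin n)) [DecidableRel G.Adj]
    (f : Fin n → Fin k → ℝ) (α : ℝ) (d : ℕ) (j : Fin k) (ℓ : ℕ) : Finset (Fin n) :=
  univ.filter fun v => f v j = 1 ∧ lvj G f α d v j = ℓ

/-- The set `V_-(j; ℓ)`. -/
def Vminus {n k : ℕ} (G : SimpleGraph (Fin n)) [DecidableRel G.Adj]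
    (f : Fin n → Fin k → ℝ) (α : ℝ) (d : ℕ) (j : Fin k) (ℓ : ℕ) : Finset (Fin n) :=
  univ.filter fun v => f v j = -1 ∧ lvj G f α d v j = ℓ

/-- The scale-`ℓ` support `J(v, ℓ)`. -/
def Jset {n k : ℕ} (G : SimpleGraph (Fin n)) [DecidableRel G.Adj]
    (f : Fin n → Fin k → ℝ) (α : ℝ) (d : ℕ) (v : Fin n) (ℓ : ℕ) : Finset (Fin k) :=
  univ.filter fun j => f v j ≠ 0 ∧ lvj G f α d v j = ℓ

/-- The scale-`ℓ` mutual support `J(v, ℓ, e)`, relative to a family `Ẽ(v, j)` of edge sets. -/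
def JsetE {n k : ℕ} (G : SimpleGraph (Fin n)) [DecidableRel G.Adj]
    (f : Fin n → Fin k → ℝ) (α : ℝ) (d : ℕ) (Et : Fin n → Fin k → Finset (Sym2 (Fin n)))
    (v : Fin n) (ℓ : ℕ) (e : Sym2 (Fin n)) : Finset (Fin k) :=
  (Jset G f α d v ℓ).filter fun j => e ∈ Et v j

end


/-! ### lattice functional part -/

structure LatFun {I : Type*} (M : (I → ℝ) → ℝ) (q C : ℝ) : Prop where
  nonneg : ∀ x, 0 ≤ M x
  mono : ∀ x y, 0 ≤ x → x ≤ y → M x ≤ M y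
  hom : ∀ (c : ℝ) x, 0 ≤ c → M (c • x) = c * M x
  subadd : ∀ x y, M (x + y) ≤ M x + M y
  lower : ∀ (m : ℕ) (x : Fin m → I → ℝ), (∀ i, 0 ≤ x i) →
    ∑ i, M (x i) ^ q ≤ C ^ q * M (∑ i, x i) ^ q

theorem LatFun.zero {I : Type*} {M : (I → ℝ) → ℝ} {q C : ℝ} (h : LatFun M q C) : M 0 = 0 := by
  have := h.hom 0 0 le_rfl
  simpa using this

theorem LatFun.sum_le {I ι : Type*} {M : (I → ℝ) → ℝ} {q C : ℝ} (h : LatFun M q C)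
    (s : Finset ι) (x : ι → I → ℝ) : M (∑ i ∈ s, x i) ≤ ∑ i ∈ s, M (x i) := by
  induction s using Finset.induction_on with
  | empty => simp [h.zero]
  | insert a s ha ih =>
    rw [Finset.sum_insert ha, Finset.sum_insert ha]
    exact (h.subadd _ _).trans (by linarith)

theorem tangent_rpow (a b q : ℝ) (ha : 0 ≤ a) (hb : 0 ≤ b) (hq : 2 ≤ q) :
    b ^ q + q * b ^ (q - 1) * (a - b) ≤ a ^ q := by
  rcases hb.eq_or_lt with rfl | hb
  · rw [Real.zero_rpow (by linarith), Real.zero_rpow (by linarith)]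
    simpa using Real.rpow_nonneg ha q
  · have h1 := one_add_mul_self_le_rpow_one_add (s := a / b - 1)
      (by have : 0 ≤ a / b := by positivity
          linarith) (p := q) (by linarith)
    have h2 : (1 + (a / b - 1)) = a / b := by ring
    rw [h2, Real.div_rpow ha hb.le, le_div_iff₀ (by positivity)] at h1
    have h3 : b ^ (q - 1) = b ^ q / b := by rw [Real.rpow_sub hb, Real.rpow_one]
    rw [h3]
    refine le_trans (le_of_eq ?_) h1
    field_simp

theorem LatFun.concave {I ι : Type*} {M : (I → ℝ) → ℝ} {q C : ℝ} (h : LatFun M q C)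
    (hq : 2 ≤ q) (T : Finset ι) (z : ι → I → ℝ) (u : I → ℝ) (hu : 0 ≤ u)
    (hz0 : ∀ v, 0 ≤ z v) (hz1 : ∀ v, z v ≤ 1) (P : ℝ) (hP0 : 0 ≤ P)
    (hP : ∀ i, ∑ v ∈ T, z v i ≤ P) :
    ∑ v ∈ T, M (z v * u) ^ q ≤ q * P * (C ^ q * M u ^ q) := by
  set W : Set ℝ := {s | ∃ (m : ℕ) (x : Fin m → I → ℝ), (∀ i, 0 ≤ x i) ∧ (∑ i, x i ≤ u) ∧
    s = ∑ i, M (x i) ^ q} with hW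
  have hub : ∀ s ∈ W, s ≤ C ^ q * M u ^ q := by
    rintro s ⟨m, x, hx0, hxu, rfl⟩
    refine (h.lower m x hx0).trans ?_
    rcases Nat.eq_zero_or_pos m with rfl | hm
    · have h0 := h.lower 1 (fun _ => u) (fun _ => hu)
      simp only [univ_eq_empty, sum_empty, h.zero]
      rw [Real.zero_rpow (by linarith)]
      have : 0 ≤ M u ^ q := Real.rpow_nonneg (h.nonneg u) q
      simp at h0
      linarith
    · have hC : 0 ≤ C ^ q ∨ M u ^ q = 0 := by
        have h0 := h.lower 1 (fun _ => u) (fun _ => hu)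
        simp at h0
        have h1 : 0 ≤ M u ^ q := Real.rpow_nonneg (h.nonneg u) q
        by_contra hcon
        push Not at hcon
        have : 0 < M u ^ q := lt_of_le_of_ne h1 (Ne.symm hcon.2)
        nlinarith [hcon.1]
      have hle : M (∑ i, x i) ^ q ≤ M u ^ q :=
        Real.rpow_le_rpow (h.nonneg _) (h.mono _ _ (Finset.sum_nonneg fun i _ => hx0 i) hxu)
          (by linarith)
      rcases hC with hC | hC
      · exact mul_le_mul_of_nonneg_left hle hC
      · have : M (∑ i, x i) ^ q = 0 := le_antisymm (by linarith)
          (Real.rpow_nonneg (h.nonneg _) q)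
        rw [this, hC]
  have hne : W.Nonempty := ⟨_, 0, Fin.elim0, fun i => i.elim0, by simpa using hu, rfl⟩
  have hbdd : BddAbove W := ⟨_, fun s hs => hub s hs⟩
  set D := sSup W with hD
  have hDle : D ≤ C ^ q * M u ^ q := csSup_le hne hub
  have key : ∑ v ∈ T, M (z v * u) ^ q ≤ q * P * D := by
    refine le_of_forall_pos_le_add fun η hη => ?_
    have hη' : 0 < η / (T.card + 1) := by positivity
    obtain ⟨s, ⟨m, x, hx0, hxu, hs⟩, hsD⟩ := exists_lt_of_lt_csSup hne
      (show D - η / (T.card + 1) < sSup W by rw [← hD]; linarith)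
    have hsle : s ≤ D := le_csSup hbdd ⟨m, x, hx0, hxu, hs⟩
    have h1 : ∀ v, M (z v * u) ^ q + ∑ i, M (x i * (1 - z v)) ^ q ≤ D := by
      intro v
      refine le_csSup hbdd ⟨m + 1, Fin.cons (z v * u) (fun i => x i * (1 - z v)), ?_, ?_, ?_⟩
      · intro i
        refine Fin.cases ?_ ?_ i
        · simpa using mul_nonneg (hz0 v) hu
        · intro i
          simpa using mul_nonneg (hx0 i) (sub_nonneg.2 (hz1 v))
      · rw [Fin.sum_univ_succ]
        simp only [Fin.cons_zero, Fin.cons_succ]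
        rw [← Finset.sum_mul]
        have : (∑ i, x i) * (1 - z v) ≤ u * (1 - z v) :=
          mul_le_mul_of_nonneg_right hxu (sub_nonneg.2 (hz1 v))
        calc z v * u + (∑ i, x i) * (1 - z v) ≤ z v * u + u * (1 - z v) := by gcongr
          _ = u := by ring
      · rw [Fin.sum_univ_succ]; simp
    have h2 : ∀ i, (T.card - q * P) * M (x i) ^ q ≤ ∑ v ∈ T, M (x i * (1 - z v)) ^ q := by
      intro i
      have hb := h.nonneg (x i)
      have h3 : (T.card - P) * M (x i) ≤ ∑ v ∈ T, M (x i * (1 - z v)) := by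
        by_cases hKP : (T.card : ℝ) - P ≤ 0
        · exact (mul_nonpos_of_nonpos_of_nonneg hKP hb).trans
            (Finset.sum_nonneg fun v _ => h.nonneg _)
        · push Not at hKP
          rw [← h.hom _ _ hKP.le]
          refine (h.mono _ _ (smul_nonneg hKP.le (hx0 i)) ?_).trans (h.sum_le _ _)
          intro j
          simp only [Pi.smul_apply, smul_eq_mul, Finset.sum_apply, Pi.mul_apply, Pi.sub_apply,
            Pi.one_apply]
          rw [← Finset.mul_sum, Finset.sum_sub_distrib, mul_comm]
          refine mul_le_mul_of_nonneg_left ?_ (hx0 i j)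
          have := hP j
          simp
          linarith
      have h4 : ∀ v ∈ T, M (x i) ^ q + q * M (x i) ^ (q - 1) * (M (x i * (1 - z v)) - M (x i))
          ≤ M (x i * (1 - z v)) ^ q := fun v _ => tangent_rpow _ _ _ (h.nonneg _) hb hq
      refine le_trans ?_ (Finset.sum_le_sum h4)
      rw [Finset.sum_add_distrib, ← Finset.mul_sum, Finset.sum_sub_distrib]
      simp only [sum_const, nsmul_eq_mul]
      have h5 : 0 ≤ q * M (x i) ^ (q - 1) :=
        mul_nonneg (by linarith) (Real.rpow_nonneg hb _)
      have h6 : M (x i) ^ (q - 1) * M (x i) = M (x i) ^ q := by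
        rw [← Real.rpow_add_one' hb (by linarith)]; congr 1; ring
      have h7 := mul_le_mul_of_nonneg_left h3 h5
      have h8 : q * M (x i) ^ (q - 1) * ((T.card - P) * M (x i)) =
        q * (T.card - P) * M (x i) ^ q := by rw [← h6]; ring
      have h9 : q * M (x i) ^ (q - 1) * (T.card * M (x i)) = q * T.card * M (x i) ^ q := by
        rw [← h6]; ring
      nlinarith
    have h3 : ∑ v ∈ T, M (z v * u) ^ q + ∑ v ∈ T, ∑ i, M (x i * (1 - z v)) ^ q ≤ T.card * D := by
      rw [← Finset.sum_add_distrib]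
      refine (Finset.sum_le_sum fun v _ => h1 v).trans ?_
      simp
    have h4 : (T.card - q * P) * s ≤ ∑ v ∈ T, ∑ i, M (x i * (1 - z v)) ^ q := by
      rw [Finset.sum_comm, hs, Finset.mul_sum]
      exact Finset.sum_le_sum fun i _ => h2 i
    have h5 : q * P * s ≤ q * P * D := mul_le_mul_of_nonneg_left hsle (by positivity)
    have h6 : (T.card : ℝ) * (D - s) ≤ η := by
      have h7 : (T.card : ℝ) * (D - s) ≤ T.card * (η / (T.card + 1)) :=
        mul_le_mul_of_nonneg_left (by linarith) (by positivity)
      refine h7.trans ?_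
      rw [mul_div_assoc', div_le_iff₀ (by positivity)]
      nlinarith
    nlinarith
  exact key.trans (mul_le_mul_of_nonneg_left hDle (by positivity))

/-! ### graph part -/

theorem edist_le_succ {V : Type*} (G : SimpleGraph V) {v x : V} {r : ℕ}
    (h : G.edist v x ≤ ((r + 1 : ℕ) : ℕ∞)) :
    v = x ∨ ∃ y, G.Adj y x ∧ G.edist v y ≤ (r : ℕ∞) := by
  obtain ⟨p, hp⟩ := SimpleGraph.exists_walk_of_edist_ne_top
    (ne_top_of_le_ne_top (ENat.natCast_ne_top _) h)
  rw [← hp] at h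
  have h' : p.length ≤ r + 1 := by exact_mod_cast h
  rw [← SimpleGraph.Walk.length_reverse] at h'
  cases hpr : p.reverse with
  | nil => left; rfl
  | @cons _ y _ hadj p' =>
    right
    rw [hpr] at h'
    refine ⟨y, hadj.symm, ?_⟩
    rw [SimpleGraph.edist_comm]
    refine (SimpleGraph.edist_le p').trans ?_
    simp only [SimpleGraph.Walk.length_cons] at h'
    exact_mod_cast (by omega : p'.length ≤ r)

theorem edist_le_of_adj {V : Type*} (G : SimpleGraph V) {v x y : V} {r : ℕ}
    (hxy : G.Adj x y) (h : G.edist v x ≤ (r : ℕ∞)) : G.edist v y ≤ ((r + 1 : ℕ) : ℕ∞) := by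
  refine (SimpleGraph.edist_triangle (v := x)).trans ?_
  rw [SimpleGraph.edist_eq_one_iff_adj.2 hxy]
  push_cast
  gcongr

theorem sphere_step {n d : ℕ} (G : SimpleGraph (Fin n)) [DecidableRel G.Adj]
    (hreg : ∀ v, G.degree v = d) (v : Fin n) (r : ℕ) :
    (univ.filter fun u => G.edist v u = ((r + 1 : ℕ) : ℕ∞)).card ≤ d * (d - 1) ^ r := by
  induction r with
  | zero =>
    rw [pow_zero, mul_one, ← hreg v, ← SimpleGraph.card_neighborFinset_eq_degree]
    refine Finset.card_le_card fun u hu => ?_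
    simp only [mem_filter, mem_univ, true_and] at hu
    rw [SimpleGraph.mem_neighborFinset]
    exact SimpleGraph.edist_eq_one_iff_adj.1 (by simpa using hu)
  | succ r ih =>
    have hsub : (univ.filter fun u => G.edist v u = ((r + 1 + 1 : ℕ) : ℕ∞)) ⊆
        (univ.filter fun u => G.edist v u = ((r + 1 : ℕ) : ℕ∞)).biUnion
          (fun x => (G.neighborFinset x).filter fun u => ¬ G.edist v u ≤ (r : ℕ∞)) := by
      intro u hu
      simp only [mem_filter, mem_univ, true_and] at hu
      simp only [mem_biUnion, mem_filter, mem_univ, true_and, SimpleGraph.mem_neighborFinset]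
      rcases edist_le_succ G hu.le with h | ⟨y, hy, hvy⟩
      · subst h
        rw [SimpleGraph.edist_self] at hu
        exact absurd hu.symm (by exact_mod_cast (by omega : r + 1 + 1 ≠ 0))
      · have hny : ¬ G.edist v y ≤ (r : ℕ∞) := fun hc => by
          have := edist_le_of_adj G hy hc
          rw [hu] at this
          have : r + 1 + 1 ≤ r + 1 := by exact_mod_cast this
          omega
        refine ⟨y, le_antisymm hvy ?_, hy, ?_⟩
        · push Not at hny
          have := Order.add_one_le_of_lt hny
          exact_mod_cast this
        · rw [hu]
          intro hc
          have : r + 1 + 1 ≤ r := by exact_mod_cast hc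
          omega
    refine (Finset.card_le_card hsub).trans ?_
    refine (Finset.card_biUnion_le_card_mul _ _ (d - 1) ?_).trans ?_
    · intro x hx
      simp only [mem_filter, mem_univ, true_and] at hx
      rcases edist_le_succ G hx.le with h | ⟨y, hy, hvy⟩
      · subst h
        rw [SimpleGraph.edist_self] at hx
        exact absurd hx.symm (by exact_mod_cast (by omega : r + 1 ≠ 0))
      · have : ((G.neighborFinset x).filter fun u => ¬ G.edist v u ≤ (r : ℕ∞)) ⊆
            (G.neighborFinset x).erase y := by
          intro u hu
          simp only [mem_filter] at hu
          refine Finset.mem_erase.2 ⟨?_, hu.1⟩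
          rintro rfl
          exact hu.2 hvy
        refine (Finset.card_le_card this).trans ?_
        rw [Finset.card_erase_of_mem (by rw [SimpleGraph.mem_neighborFinset]; exact hy.symm),
          SimpleGraph.card_neighborFinset_eq_degree, hreg]
    · calc _ ≤ d * (d - 1) ^ r * (d - 1) := Nat.mul_le_mul_right _ ih
        _ = d * (d - 1) ^ (r + 1) := by ring

theorem ball_card {n d : ℕ} (hd : 3 ≤ d) (G : SimpleGraph (Fin n)) [DecidableRel G.Adj]
    (hreg : ∀ v, G.degree v = d) (v : Fin n) (r : ℕ) :
    ((univ.filter fun u => G.edist v u ≤ (r : ℕ∞)).card : ℝ) ≤ 3 * ((d : ℝ) - 1) ^ r := by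
  have hcast : ((d - 1 : ℕ) : ℝ) = (d : ℝ) - 1 := by
    rw [Nat.cast_sub (by omega)]; simp
  have hd' : (3 : ℝ) ≤ d := by exact_mod_cast hd
  induction r with
  | zero =>
    have : (univ.filter fun u => G.edist v u ≤ ((0 : ℕ) : ℕ∞)) ⊆ {v} := by
      intro u hu
      simp at hu
      simp [hu]
    have := Finset.card_le_card this
    rw [Finset.card_singleton] at this
    have : ((univ.filter fun u => G.edist v u ≤ ((0 : ℕ) : ℕ∞)).card : ℝ) ≤ 1 := by
      exact_mod_cast this
    rw [pow_zero]
    linarith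
  | succ r ih =>
    have hsub : (univ.filter fun u => G.edist v u ≤ ((r + 1 : ℕ) : ℕ∞)) ⊆
        (univ.filter fun u => G.edist v u ≤ (r : ℕ∞)) ∪
        (univ.filter fun u => G.edist v u = ((r + 1 : ℕ) : ℕ∞)) := by
      intro u hu
      simp only [mem_filter, mem_univ, true_and, mem_union] at hu ⊢
      by_cases h : G.edist v u ≤ (r : ℕ∞)
      · exact Or.inl h
      · right
        refine le_antisymm hu ?_
        push Not at h
        have := Order.add_one_le_of_lt h
        exact_mod_cast this
    have h1 := (Finset.card_le_card hsub).trans (Finset.card_union_le _ _)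
    have h2 := sphere_step G hreg v r
    have h3 : ((univ.filter fun u => G.edist v u ≤ ((r + 1 : ℕ) : ℕ∞)).card : ℝ) ≤
        ((univ.filter fun u => G.edist v u ≤ (r : ℕ∞)).card : ℝ) + d * ((d - 1 : ℕ) : ℝ) ^ r := by
      exact_mod_cast h1.trans (Nat.add_le_add_left h2 _)
    rw [hcast] at h3
    have h4 : 0 < ((d : ℝ) - 1) ^ r := pow_pos (by linarith) r
    rw [pow_succ]
    nlinarith

theorem crossing {V : Type*} (G : SimpleGraph V) (A : Set V) {v u : V} (p : G.Walk v u)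
    (hv : v ∈ A) (hu : u ∉ A) :
    ∃ i x y, i < p.length ∧ G.Adj x y ∧ x ∈ A ∧ y ∉ A ∧ G.edist v x ≤ (i : ℕ∞) ∧
      G.edist y u ≤ ((p.length - 1 - i : ℕ) : ℕ∞) := by
  induction p with
  | nil => exact absurd hv hu
  | @cons a b c hadj p ih =>
    by_cases hb : b ∈ A
    · obtain ⟨i, x, y, hi, hxy, hx, hy, h1, h2⟩ := ih hb hu
      refine ⟨i + 1, x, y, by simpa using hi, hxy, hx, hy, ?_, ?_⟩
      · rw [SimpleGraph.edist_comm]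
        rw [SimpleGraph.edist_comm] at h1
        exact edist_le_of_adj G hadj.symm h1
      · refine h2.trans ?_
        simp only [SimpleGraph.Walk.length_cons]
        exact_mod_cast (by omega)
    · refine ⟨0, a, b, by simp, hadj, hv, hb, by simp, ?_⟩
      refine (SimpleGraph.edist_le p).trans ?_
      simp

/-- boundary edges -/
noncomputable def bdE {n : ℕ} (G : SimpleGraph (Fin n)) [DecidableRel G.Adj] (A : Finset (Fin n)) :
    Finset (Sym2 (Fin n)) :=
  G.edgeFinset.filter fun e => ∃ a b, e = s(a, b) ∧ a ∈ A ∧ b ∉ A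

/-- boundary edges near a vertex -/
noncomputable def nbd {n : ℕ} (G : SimpleGraph (Fin n)) [DecidableRel G.Adj] (A : Finset (Fin n))
    (v : Fin n) (i : ℕ) : Finset (Sym2 (Fin n)) :=
  (bdE G A).filter fun e => edgeDist G v e ≤ (i : ℕ∞)

theorem reach_card {n d : ℕ} (hd : 3 ≤ d) (G : SimpleGraph (Fin n)) [DecidableRel G.Adj]
    (hreg : ∀ v, G.degree v = d) (A S : Finset (Fin n)) (hSA : S ⊆ A) (l : ℕ) :
    ((univ.filter fun v => vertexSetDist G v S ≤ ((l + 1 : ℕ) : ℕ∞)).card : ℝ) ≤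
      A.card + ∑ v ∈ S, ∑ i ∈ range (l + 1),
        ((nbd G A v i).card : ℝ) * (3 * ((d : ℝ) - 1) ^ (l - i)) := by
  have hsub : (univ.filter fun v => vertexSetDist G v S ≤ ((l + 1 : ℕ) : ℕ∞)) ⊆
      A ∪ S.biUnion fun v => (range (l + 1)).biUnion fun i => (nbd G A v i).biUnion fun e =>
        univ.filter fun u => ∃ y, y ∈ e ∧ y ∉ A ∧ G.edist y u ≤ ((l - i : ℕ) : ℕ∞) := by
    intro u hu
    simp only [mem_filter, mem_univ, true_and] at hu
    rw [mem_union]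
    by_cases huA : u ∈ A
    · exact Or.inl huA
    right
    have : ∃ v ∈ S, G.edist u v ≤ ((l + 1 : ℕ) : ℕ∞) := by
      unfold vertexSetDist at hu
      rwa [Finset.inf_le_iff (ENat.natCast_lt_top _)] at hu
    obtain ⟨v, hvS, hv⟩ := this
    rw [SimpleGraph.edist_comm] at hv
    obtain ⟨p, hp⟩ := SimpleGraph.exists_walk_of_edist_ne_top
      (ne_top_of_le_ne_top (ENat.natCast_ne_top _) hv)
    rw [← hp] at hv
    have hlen : p.length ≤ l + 1 := by exact_mod_cast hv
    obtain ⟨i, x, y, hi, hxy, hx, hy, h1, h2⟩ := crossing G (A : Set (Fin n)) p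
      (by exact_mod_cast hSA hvS) (by exact_mod_cast huA)
    simp only [mem_biUnion, mem_range, mem_filter, mem_univ, true_and, nbd, bdE]
    refine ⟨v, hvS, i, by omega, s(x, y), ⟨⟨?_, x, y, rfl, by exact_mod_cast hx,
      by exact_mod_cast hy⟩, ?_⟩, y, by simp, by exact_mod_cast hy, h2.trans ?_⟩
    · simpa using hxy
    · simp only [edgeDist, Sym2.lift_mk]
      exact (min_le_left _ _).trans h1
    · exact_mod_cast (by omega)
  have h1 := (Finset.card_le_card hsub).trans (Finset.card_union_le _ _)
  have h2 : ((S.biUnion fun v => (range (l + 1)).biUnion fun i => (nbd G A v i).biUnion fun e =>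
        univ.filter fun u => ∃ y, y ∈ e ∧ y ∉ A ∧ G.edist y u ≤ ((l - i : ℕ) : ℕ∞)).card : ℝ) ≤
      ∑ v ∈ S, ∑ i ∈ range (l + 1), ((nbd G A v i).card : ℝ) * (3 * ((d : ℝ) - 1) ^ (l - i)) := by
    refine (Nat.cast_le.2 Finset.card_biUnion_le).trans ?_
    rw [Nat.cast_sum]
    refine Finset.sum_le_sum fun v _ => ?_
    refine (Nat.cast_le.2 Finset.card_biUnion_le).trans ?_
    rw [Nat.cast_sum]
    refine Finset.sum_le_sum fun i _ => ?_
    refine (Nat.cast_le.2 Finset.card_biUnion_le).trans ?_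
    rw [Nat.cast_sum]
    rw [← nsmul_eq_mul]
    refine Finset.sum_le_card_nsmul _ _ _ fun e he => ?_
    simp only [nbd, bdE, mem_filter] at he
    obtain ⟨⟨-, a, b, rfl, ha, hb⟩, -⟩ := he
    refine le_trans ?_ (ball_card hd G hreg b (l - i))
    refine Nat.cast_le.2 (Finset.card_le_card fun u hu => ?_)
    simp only [mem_filter, mem_univ, true_and, Sym2.mem_iff] at hu ⊢
    obtain ⟨y, rfl | rfl, hy, h⟩ := hu
    · exact absurd ha hy
    · exact h
  have h3 : ((univ.filter fun v => vertexSetDist G v S ≤ ((l + 1 : ℕ) : ℕ∞)).card : ℝ) ≤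
      A.card + ((S.biUnion fun v => (range (l + 1)).biUnion fun i =>
        (nbd G A v i).biUnion fun e =>
        univ.filter fun u => ∃ y, y ∈ e ∧ y ∉ A ∧ G.edist y u ≤ ((l - i : ℕ) : ℕ∞)).card : ℝ) := by
    exact_mod_cast h1
  linarith

theorem lemma_one {n d : ℕ} (hd : 3 ≤ d) (G : SimpleGraph (Fin n)) [DecidableRel G.Adj]
    (hreg : ∀ v, G.degree v = d) (α ρ : ℝ) (hα : 0 < α ∧ α ≤ 1) (hρ : 0 < ρ ∧ ρ < 1)
    (hA : ExpanA n d G α) (A S : Finset (Fin n)) (hcard : (A.card : ℝ) ≤ n / 2)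
    (hSA : S ⊆ A) (hS : S.Nonempty) (l : ℕ)
    (hsm : ∀ v ∈ S, ∀ i < l, ((nbd G A v i).card : ℝ) ≤
      α / 20 * ((1 - ρ) * ρ ^ i) * ((d : ℝ) - 1) ^ i) :
    α * ((d : ℝ) - 1) ^ l * S.card ≤ 3 * n / 4 := by
  have hd' : (3 : ℝ) ≤ d := by exact_mod_cast hd
  have hn : (0 : ℝ) < n := by
    obtain ⟨v, -⟩ := hS
    exact_mod_cast v.pos
  induction l with
  | zero =>
    have : (S.card : ℝ) ≤ A.card := by exact_mod_cast Finset.card_le_card hSA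
    rw [pow_zero, mul_one]
    have h0 : (0 : ℝ) ≤ S.card := by positivity
    nlinarith [hα.1, hα.2]
  | succ l ih =>
    have ih := ih fun v hv i hi => hsm v hv i (by omega)
    by_contra hcon
    push Not at hcon
    have h1 := hA S hS (l + 1) (by omega)
    rw [min_eq_left hcon.le] at h1
    have h2 := reach_card hd G hreg A S hSA l
    have h3 : ∑ v ∈ S, ∑ i ∈ range (l + 1),
        ((nbd G A v i).card : ℝ) * (3 * ((d : ℝ) - 1) ^ (l - i)) ≤
        ∑ v ∈ S, 3 * (α / 20) * ((d : ℝ) - 1) ^ l := by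
      refine Finset.sum_le_sum fun v hv => ?_
      calc _ ≤ ∑ i ∈ range (l + 1), 3 * (α / 20) * ((d : ℝ) - 1) ^ l * ((1 - ρ) * ρ ^ i) := by
            refine Finset.sum_le_sum fun i hi => ?_
            rw [mem_range] at hi
            have h5 : ((d : ℝ) - 1) ^ l = ((d : ℝ) - 1) ^ i * ((d : ℝ) - 1) ^ (l - i) := by
              rw [← pow_add]; congr 1; omega
            rw [h5]
            have h6 : 0 < ((d : ℝ) - 1) ^ (l - i) := pow_pos (by linarith) _
            calc _ ≤ α / 20 * ((1 - ρ) * ρ ^ i) * ((d : ℝ) - 1) ^ i *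
                  (3 * ((d : ℝ) - 1) ^ (l - i)) := by
                  gcongr
                  exact hsm v hv i hi
              _ = _ := by ring
        _ = 3 * (α / 20) * ((d : ℝ) - 1) ^ l * (1 - ρ ^ (l + 1)) := by
            rw [← Finset.mul_sum, ← Finset.mul_sum, mul_neg_geom_sum]
        _ ≤ 3 * (α / 20) * ((d : ℝ) - 1) ^ l * 1 := by
            have h6 : 0 < ((d : ℝ) - 1) ^ l := pow_pos (by linarith) _
            have h7 : 0 < ρ ^ (l + 1) := pow_pos hρ.1 _
            have := hα.1
            gcongr
            linarith
        _ = _ := by ring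
    rw [Finset.sum_const, nsmul_eq_mul] at h3
    nlinarith

/-- the scale of a vertex -/
noncomputable def lev {n : ℕ} (d : ℕ) (G : SimpleGraph (Fin n)) [DecidableRel G.Adj] (α ρ : ℝ)
    (A : Finset (Fin n)) (v : Fin n) : ℕ :=
  sInf {i : ℕ | α / 20 * ((1 - ρ) * ρ ^ i) * ((d : ℝ) - 1) ^ i < ((nbd G A v i).card : ℝ)}

theorem lev_spec {n d : ℕ} (hd : 3 ≤ d) (G : SimpleGraph (Fin n)) [DecidableRel G.Adj]
    (hreg : ∀ v, G.degree v = d) (α ρ : ℝ) (hα : 0 < α ∧ α ≤ 1) (hρ : 0 < ρ ∧ ρ < 1)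
    (hA : ExpanA n d G α) (A : Finset (Fin n)) (hcard : (A.card : ℝ) ≤ n / 2)
    (v : Fin n) (hv : v ∈ A) :
    α / 20 * ((1 - ρ) * ρ ^ (lev d G α ρ A v)) * ((d : ℝ) - 1) ^ (lev d G α ρ A v) <
      ((nbd G A v (lev d G α ρ A v)).card : ℝ) := by
  have hd' : (3 : ℝ) ≤ d := by exact_mod_cast hd
  refine Nat.sInf_mem (s := {i : ℕ | α / 20 * ((1 - ρ) * ρ ^ i) * ((d : ℝ) - 1) ^ i <
    ((nbd G A v i).card : ℝ)}) ?_
  by_contra hcon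
  rw [Set.not_nonempty_iff_eq_empty, Set.eq_empty_iff_forall_notMem] at hcon
  obtain ⟨l, hl⟩ := pow_unbounded_of_one_lt (3 * n / 4 / α) (show 1 < (d : ℝ) - 1 by linarith)
  have := lemma_one hd G hreg α ρ hα hρ hA A {v} hcard (by simpa using hv) (by simp) l
    (fun u hu i _ => by
      rw [mem_singleton] at hu
      subst hu
      simpa using hcon i)
  rw [div_lt_iff₀ hα.1] at hl
  simp at this
  linarith

theorem lev_small {n d : ℕ} (G : SimpleGraph (Fin n)) [DecidableRel G.Adj]
    (α ρ : ℝ) (A : Finset (Fin n)) (v : Fin n) (i : ℕ) (hi : i < lev d G α ρ A v) :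
    ((nbd G A v i).card : ℝ) ≤ α / 20 * ((1 - ρ) * ρ ^ i) * ((d : ℝ) - 1) ^ i := by
  simpa using Nat.notMem_of_lt_sInf hi

theorem peel {n d : ℕ} (hd : 3 ≤ d) (G : SimpleGraph (Fin n)) [DecidableRel G.Adj]
    (α ε L : ℝ) (hα : 0 < α ∧ α ≤ 1) (hε : 0 < ε ∧ ε ≤ 1) (hL : 1 ≤ L)
    (hB : ExpanB n d G α ε L) (r : ℕ) (S : Finset (Fin n))
    (hS : α * ((d : ℝ) - 1) ^ r * S.card ≤ 3 * n / 4) :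
    ∃ bad : Fin n → Finset (Sym2 (Fin n)),
      (∀ v ∈ S, (((bad v).filter fun e => edgeDist G v e ≤ (r : ℕ∞)).card : ℝ) ≤
        L * ((d : ℝ) - 1 - ε) ^ (r + 1)) ∧
      ∀ e ∈ G.edgeFinset, ((S.filter fun v => edgeDist G v e ≤ (r : ℕ∞) ∧ e ∉ bad v).card : ℝ) ≤
        L * ((d : ℝ) - 1 - ε) ^ (r + 1) := by
  have hd' : (3 : ℝ) ≤ d := by exact_mod_cast hd
  have hpos : 0 ≤ L * ((d : ℝ) - 1 - ε) ^ (r + 1) :=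
    mul_nonneg (by linarith) (pow_nonneg (by linarith [hε.2]) _)
  induction hk : S.card generalizing S with
  | zero =>
    rw [Finset.card_eq_zero] at hk
    subst hk
    exact ⟨fun _ => ∅, by simp, fun e _ => by simpa using hpos⟩
  | succ k ih =>
    have hne : S.Nonempty := Finset.card_pos.1 (by omega)
    obtain ⟨v, hv, hT⟩ := hB S hne (r + 1) (by omega) (by simpa using hS)
    have hcard : (S.erase v).card = k := by rw [Finset.card_erase_of_mem hv]; omega
    obtain ⟨bad', h1, h2⟩ := ih (S.erase v) (by
      refine le_trans ?_ hS
      have : 0 < α * ((d : ℝ) - 1) ^ r := mul_pos hα.1 (pow_pos (by linarith) _)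
      have h3 : ((S.erase v).card : ℝ) ≤ S.card := by
        exact_mod_cast Finset.card_le_card (Finset.erase_subset v S)
      exact mul_le_mul_of_nonneg_left h3 this.le) hcard
    simp only [Nat.add_sub_cancel] at hT
    refine ⟨Function.update bad' v (G.edgeFinset.filter fun e =>
            L * ((d : ℝ) - 1 - ε) ^ (r + 1) ≤
              ((S.filter fun u => edgeDist G u e ≤ (r : ℕ∞)).card : ℝ)), ?_, ?_⟩
    · intro u hu
      by_cases huv : u = v
      · subst huv
        rw [Function.update_self]
        exact hT
      · rw [Function.update_of_ne huv]
        exact h1 u (Finset.mem_erase.2 ⟨huv, hu⟩)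
    · intro e he
      by_cases heT : L * ((d : ℝ) - 1 - ε) ^ (r + 1) ≤
              ((S.filter fun u => edgeDist G u e ≤ (r : ℕ∞)).card : ℝ)
      · refine le_trans ?_ (h2 e he)
        refine Nat.cast_le.2 (Finset.card_le_card fun u hu => ?_)
        simp only [mem_filter, mem_erase] at hu ⊢
        by_cases huv : u = v
        · subst huv
          rw [Function.update_self] at hu
          exact absurd (Finset.mem_filter.2 ⟨he, by convert heT⟩) hu.2.2
        · rw [Function.update_of_ne huv] at hu
          exact ⟨⟨huv, hu.1⟩, hu.2⟩
      · push Not at heT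
        refine le_trans ?_ heT.le
        refine Nat.cast_le.2 (Finset.card_le_card fun u hu => ?_)
        simp only [mem_filter] at hu ⊢
        exact ⟨hu.1, hu.2.1⟩

theorem near_card {n d : ℕ} (hd : 3 ≤ d) (G : SimpleGraph (Fin n)) [DecidableRel G.Adj]
    (hreg : ∀ v, G.degree v = d) (e : Sym2 (Fin n)) (r : ℕ) :
    ((univ.filter fun v => edgeDist G v e ≤ (r : ℕ∞)).card : ℝ) ≤ 6 * ((d : ℝ) - 1) ^ r := by
  induction e with
  | h a b =>
    have hsub : (univ.filter fun v => edgeDist G v s(a, b) ≤ (r : ℕ∞)) ⊆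
        (univ.filter fun u => G.edist a u ≤ (r : ℕ∞)) ∪
        (univ.filter fun u => G.edist b u ≤ (r : ℕ∞)) := by
      intro u hu
      simp only [mem_filter, mem_univ, true_and, edgeDist, Sym2.lift_mk, mem_union,
        min_le_iff] at hu ⊢
      rwa [G.edist_comm (u := a), G.edist_comm (u := b)]
    have h1 := (Finset.card_le_card hsub).trans (Finset.card_union_le _ _)
    have h2 := ball_card hd G hreg a r
    have h3 := ball_card hd G hreg b r
    have h4 : ((univ.filter fun v => edgeDist G v s(a, b) ≤ (r : ℕ∞)).card : ℝ) ≤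
      ((univ.filter fun u => G.edist a u ≤ (r : ℕ∞)).card : ℝ) +
        ((univ.filter fun u => G.edist b u ≤ (r : ℕ∞)).card : ℝ) := by exact_mod_cast h1
    linarith


/-! ### combining -/

theorem transfer {I V E : Type*} [Fintype V] [DecidableEq V] [DecidableEq E] {M : (I → ℝ) → ℝ} {q C : ℝ} (h : LatFun M q C)
    (Es : Finset E) (S : I → Finset V) (g : I → V → Finset E) (c B : ℝ) (hc : 0 < c)
    (hg : ∀ j, ∀ v ∈ S j, c ≤ ((g j v).card : ℝ)) (hgE : ∀ j v, g j v ⊆ Es)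
    (D : E → I → ℝ)
    (hB : ∀ e ∈ Es, ∑ v, M (fun j => if v ∈ S j ∧ e ∈ g j v then 1 else 0) ≤ B * M (D e)) :
    ∑ v, M (fun j => if v ∈ S j then 1 else 0) ≤ B / c * ∑ e ∈ Es, M (D e) := by
  have h1 : ∀ v, c * M (fun j => if v ∈ S j then 1 else 0) ≤
      ∑ e ∈ Es, M (fun j => if v ∈ S j ∧ e ∈ g j v then 1 else 0) := by
    intro v
    rw [← h.hom _ _ hc.le]
    refine (h.mono _ _ ?_ ?_).trans (h.sum_le _ _)
    · intro j
      simp only [Pi.smul_apply, smul_eq_mul, Pi.zero_apply]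
      split_ifs <;> simp [hc.le]
    · intro j
      simp only [Pi.smul_apply, smul_eq_mul, Finset.sum_apply]
      by_cases hv : v ∈ S j
      · simp only [hv, if_true, true_and, mul_one]
        rw [Finset.sum_ite_mem, Finset.inter_eq_right.2 (hgE j v)]
        simpa using hg j v hv
      · simp [hv]
  have h2 : c * ∑ v, M (fun j => if v ∈ S j then 1 else 0) ≤ B * ∑ e ∈ Es, M (D e) := by
    rw [Finset.mul_sum, Finset.mul_sum]
    refine (Finset.sum_le_sum fun v _ => h1 v).trans ?_
    rw [Finset.sum_comm]
    exact Finset.sum_le_sum hB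
  rw [div_mul_eq_mul_div, le_div_iff₀ hc]
  linarith

theorem per_edge_trivial {I V E : Type*} [Fintype V] [DecidableEq V] [DecidableEq E] {M : (I → ℝ) → ℝ} {q C : ℝ}
    (h : LatFun M q C) (S : I → Finset V) (g : I → V → Finset E) (e : E) (u : I → ℝ)
    (T : Finset V) (Mr : ℝ) (hT : (T.card : ℝ) ≤ Mr)
    (hgT : ∀ j v, v ∈ S j → e ∈ g j v → v ∈ T ∧ u j = 1) (hu : 0 ≤ u) :
    ∑ v, M (fun j => if v ∈ S j ∧ e ∈ g j v then 1 else 0) ≤ Mr * M u := by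
  have h0 : ∀ v, v ∉ T → M (fun j => if v ∈ S j ∧ e ∈ g j v then 1 else 0) = 0 := by
    intro v hv
    refine Eq.trans (congrArg M ?_) h.zero
    funext j
    rw [if_neg]
    · rfl
    · exact fun hc => hv (hgT j v hc.1 hc.2).1
  rw [← Finset.sum_subset (Finset.subset_univ T) (fun v _ hv => h0 v hv)]
  refine (Finset.sum_le_card_nsmul T _ (M u) fun v _ => ?_).trans ?_
  · refine h.mono _ _ ?_ ?_
    · intro j
      simp only [Pi.zero_apply]
      split_ifs <;> simp
    · intro j
      simp only
      split_ifs with hc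
      · exact (hgT j v hc.1 hc.2).2.ge
      · exact hu j
  · rw [nsmul_eq_mul]
    exact mul_le_mul_of_nonneg_right hT (h.nonneg _)

theorem per_edge_good {I V E : Type*} [Fintype V] [DecidableEq V] [DecidableEq E] {M : (I → ℝ) → ℝ} {q C : ℝ}
    (h : LatFun M q C) (hq : 2 ≤ q) (hC : 1 ≤ C)
    (S : I → Finset V) (g : I → V → Finset E) (e : E) (u : I → ℝ)
    (T : Finset V) (Mr P X : ℝ) (hMr : 0 < Mr) (hX : 0 ≤ X) (hP0 : 0 ≤ P)
    (hT : (T.card : ℝ) ≤ Mr)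
    (hgT : ∀ j v, v ∈ S j → e ∈ g j v → v ∈ T ∧ u j = 1) (hu : 0 ≤ u)
    (hP : ∀ j, (((S j).filter fun v => e ∈ g j v).card : ℝ) ≤ P)
    (hPX : q * P ≤ Mr * X ^ q) :
    ∑ v, M (fun j => if v ∈ S j ∧ e ∈ g j v then 1 else 0) ≤ Mr * X * C * M u := by
  have h0 : ∀ v, v ∉ T → M (fun j => if v ∈ S j ∧ e ∈ g j v then 1 else 0) = 0 := by
    intro v hv
    refine Eq.trans (congrArg M ?_) h.zero
    funext j
    rw [if_neg]
    · rfl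
    · exact fun hc => hv (hgT j v hc.1 hc.2).1
  rw [← Finset.sum_subset (Finset.subset_univ T) (fun v _ hv => h0 v hv)]
  have h1 := h.concave hq T (fun v j => if v ∈ S j ∧ e ∈ g j v then 1 else 0) u hu
    (by intro v j; simp only [Pi.zero_apply]; split_ifs <;> simp)
    (by intro v j; simp only [Pi.one_apply]; split_ifs <;> simp) P hP0
    (by
      intro j
      refine le_trans ?_ (hP j)
      rw [Finset.sum_boole]
      refine Nat.cast_le.2 (Finset.card_le_card fun v hv => ?_)
      simp only [mem_filter] at hv ⊢
      exact hv.2)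
  have h2 : ∀ v, (fun j => if v ∈ S j ∧ e ∈ g j v then (1 : ℝ) else 0) * u =
      fun j => if v ∈ S j ∧ e ∈ g j v then 1 else 0 := by
    intro v
    funext j
    simp only [Pi.mul_apply]
    split_ifs with hc
    · simp [(hgT j v hc.1 hc.2).2]
    · simp
  simp only [h2] at h1
  have h3 := Real.rpow_sum_le_const_mul_sum_rpow_of_nonneg (p := q) T
    (f := fun v => M (fun j => if v ∈ S j ∧ e ∈ g j v then 1 else 0)) (by linarith)
    (fun v _ => h.nonneg _)
  have hMu := h.nonneg u
  rw [← Real.rpow_le_rpow_iff (z := q) (Finset.sum_nonneg fun v _ => h.nonneg _) (by positivity)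
    (by linarith)]
  refine h3.trans ?_
  have h4 : (T.card : ℝ) ^ (q - 1) ≤ Mr ^ (q - 1) :=
    Real.rpow_le_rpow (by positivity) hT (by linarith)
  have h5 : (0 : ℝ) ≤ C ^ q * M u ^ q := by positivity
  calc _ ≤ Mr ^ (q - 1) * (q * P * (C ^ q * M u ^ q)) := by
        refine mul_le_mul h4 h1 (Finset.sum_nonneg fun v _ => Real.rpow_nonneg (h.nonneg _) _)
          (by positivity)
    _ ≤ Mr ^ (q - 1) * (Mr * X ^ q * (C ^ q * M u ^ q)) := by gcongr
    _ = (Mr ^ (q - 1) * Mr) * X ^ q * C ^ q * M u ^ q := by ring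
    _ = (Mr * X * C * M u) ^ q := by
        rw [← Real.rpow_add_one hMr.ne', sub_add_cancel, Real.mul_rpow (by positivity) hMu,
          Real.mul_rpow (by positivity) (by positivity), Real.mul_rpow hMr.le hX]

set_option maxHeartbeats 1000000 in
theorem level_bound {n d : ℕ} {I : Type*} (q C α ε L ρ : ℝ)
    (hq : 2 ≤ q) (hC : 1 ≤ C) (hd : 3 ≤ d)
    (hα : 0 < α ∧ α ≤ 1) (hε : 0 < ε ∧ ε ≤ 1) (hL : 1 ≤ L) (hρ : 0 < ρ ∧ ρ < 1)
    (hρq : (d : ℝ) - 1 - ε ≤ ρ ^ (2 * q) * ((d : ℝ) - 1))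
    (G : SimpleGraph (Fin n)) [DecidableRel G.Adj]
    (hreg : ∀ v, G.degree v = d) (hExp : Expan n d G α ε L)
    (M : (I → ℝ) → ℝ) (h : LatFun M q C) (A : I → Finset (Fin n))
    (hA : ∀ j, ((A j).card : ℝ) ≤ n / 2) (r : ℕ) :
    ∑ v, M (fun j => if v ∈ (A j).filter (fun v => lev d G α ρ (A j) v = r) then 1 else 0) ≤
      12 * C * q * L * d / ((α / 20) ^ 2 * (1 - ρ) ^ 2) * ρ ^ r *
        ∑ e ∈ G.edgeFinset, M (fun j => if e ∈ bdE G (A j) then 1 else 0) := by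
  have hd' : (3 : ℝ) ≤ d := by exact_mod_cast hd
  obtain ⟨hα0, hα1⟩ := hα
  obtain ⟨hρ0, hρ1⟩ := hρ
  set S : I → Finset (Fin n) := fun j => (A j).filter (fun v => lev d G α ρ (A j) v = r) with hS
  set β := α / 20 with hβ
  have hβ0 : 0 < β := by positivity
  have hβ1 : β ≤ 1 := by rw [hβ]; linarith
  have hρ' : 0 < 1 - ρ := by linarith
  set Q := ∑ e ∈ G.edgeFinset, M (fun j => if e ∈ bdE G (A j) then 1 else 0) with hQ
  have hQ0 : 0 ≤ Q := Finset.sum_nonneg fun e _ => h.nonneg _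
  set Y := ((d : ℝ) - 1) ^ r with hY
  have hY0 : 0 < Y := pow_pos (by linarith) _
  set P := L * ((d : ℝ) - 1 - ε) ^ (r + 1) with hPdef
  have hlam : 0 ≤ (d : ℝ) - 1 - ε := by linarith [hε.2]
  have hP0 : 0 ≤ P := mul_nonneg (by linarith) (pow_nonneg hlam _)
  have hρr : 0 < ρ ^ r := pow_pos hρ0 r
  -- upper bound for P
  have hPle : P ≤ L * d * Y * (ρ ^ (2 * q)) ^ r := by
    have h1 : ((d : ℝ) - 1 - ε) ^ r ≤ (ρ ^ (2 * q) * ((d : ℝ) - 1)) ^ r :=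
      pow_le_pow_left₀ hlam hρq r
    rw [hPdef, pow_succ]
    rw [mul_pow] at h1
    calc L * (((d : ℝ) - 1 - ε) ^ r * ((d : ℝ) - 1 - ε))
        ≤ L * (((ρ ^ (2 * q)) ^ r * ((d : ℝ) - 1) ^ r) * d) := by
          have : (d : ℝ) - 1 - ε ≤ d := by linarith [hε.1]
          have h3 : 0 < (ρ ^ (2 * q)) ^ r := by positivity
          gcongr
          
      _ = _ := by rw [← hY]; ring
  have hspec : ∀ j, ∀ v ∈ S j, β * ((1 - ρ) * ρ ^ r) * Y ≤ ((nbd G (A j) v r).card : ℝ) := by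
    intro j v hv
    simp only [hS, mem_filter] at hv
    have := lev_spec hd G hreg α ρ ⟨hα0, hα1⟩ ⟨hρ0, hρ1⟩ hExp.1 (A j) (hA j) v hv.1
    rw [hv.2] at this
    exact this.le
  have hu : ∀ e, (0 : I → ℝ) ≤ (fun j => if e ∈ bdE G (A j) then (1 : ℝ) else 0) := by
    intro e j
    simp only [Pi.zero_apply]
    split_ifs <;> simp
  by_cases hgood : P ≤ β * ((1 - ρ) * ρ ^ r) * Y / 2
  · -- good level
    have hpe : ∀ j, ∃ bad : Fin n → Finset (Sym2 (Fin n)),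
      (∀ v ∈ S j, (((bad v).filter fun e => edgeDist G v e ≤ (r : ℕ∞)).card : ℝ) ≤ P) ∧
      ∀ e ∈ G.edgeFinset, (((S j).filter fun v => edgeDist G v e ≤ (r : ℕ∞) ∧ e ∉ bad v).card : ℝ)
        ≤ P := by
      intro j
      refine peel hd G α ε L ⟨hα0, hα1⟩ hε hL hExp.2 r (S j) ?_
      rcases (S j).eq_empty_or_nonempty with hemp | hne
      · rw [hemp]; simp; positivity
      · refine lemma_one hd G hreg α ρ ⟨hα0, hα1⟩ ⟨hρ0, hρ1⟩ hExp.1 (A j) (S j) (hA j)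
          (Finset.filter_subset _ _) hne r fun v hv i hi => ?_
        simp only [hS, mem_filter] at hv
        exact lev_small G α ρ (A j) v i (by rw [hv.2]; exact hi)
    choose bad hbad1 hbad2 using hpe
    have hc : 0 < β * ((1 - ρ) * ρ ^ r) * Y / 2 := by positivity
    have key := transfer h G.edgeFinset S (fun j v => nbd G (A j) v r \ bad j v)
      (β * ((1 - ρ) * ρ ^ r) * Y / 2) (6 * Y * (q * L * d * (ρ ^ 2) ^ r) * C) hc ?_ ?_
      (fun e j => if e ∈ bdE G (A j) then 1 else 0) ?_
    · refine key.trans ?_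
      refine mul_le_mul_of_nonneg_right ?_ hQ0
      have e1 : (6 * Y * (q * L * d * (ρ ^ 2) ^ r) * C) / (β * ((1 - ρ) * ρ ^ r) * Y / 2) =
          12 * C * q * L * d / (β * (1 - ρ)) * ρ ^ r := by
        have : (ρ ^ 2) ^ r = ρ ^ r * ρ ^ r := by rw [← mul_pow, sq]
        rw [this]
        field_simp
        ring
      rw [e1]
      refine mul_le_mul_of_nonneg_right ?_ hρr.le
      refine div_le_div_of_nonneg_left (by positivity) (by positivity) ?_
      have : β * (1 - ρ) ≤ 1 := by nlinarith
      have h2 : 0 < β * (1 - ρ) := by positivity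
      nlinarith
    · intro j v hv
      have h1 := hspec j v hv
      have h2 := hbad1 j v hv
      have h3 : (nbd G (A j) v r).card ≤ (nbd G (A j) v r \ bad j v).card +
          ((bad j v).filter fun e => edgeDist G v e ≤ (r : ℕ∞)).card := by
        refine le_trans (Finset.card_le_card ?_) (Finset.card_union_le _ _)
        intro e he
        rw [mem_union, mem_sdiff, mem_filter]
        by_cases hb : e ∈ bad j v
        · right
          exact ⟨hb, (mem_filter.1 he).2⟩
        · left; exact ⟨he, hb⟩
      have h4 : ((nbd G (A j) v r).card : ℝ) ≤ ((nbd G (A j) v r \ bad j v).card : ℝ) +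
          (((bad j v).filter fun e => edgeDist G v e ≤ (r : ℕ∞)).card : ℝ) := by exact_mod_cast h3
      linarith
    · intro j v e he
      exact (mem_filter.1 (mem_filter.1 (mem_sdiff.1 he).1).1).1
    · intro e he
      refine per_edge_good h hq hC S _ e _ (univ.filter fun v => edgeDist G v e ≤ (r : ℕ∞))
        (6 * Y) P _ (by positivity) (by positivity) hP0 (near_card hd G hreg e r) ?_ (hu e) ?_ ?_
      · intro j v hv hev
        have h1 := mem_filter.1 (mem_sdiff.1 hev).1
        exact ⟨by simpa using h1.2, by simp [h1.1]⟩
      · intro j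
        refine le_trans ?_ (hbad2 j e he)
        refine Nat.cast_le.2 (Finset.card_le_card fun v hv => ?_)
        rw [mem_filter, mem_sdiff] at hv
        rw [mem_filter]
        exact ⟨hv.1, (mem_filter.1 hv.2.1).2, hv.2.2⟩
      · have hx : 1 ≤ q * L * d := by
          have : 1 ≤ q * L := by nlinarith
          nlinarith
        have h1 : q * L * d ≤ (q * L * d) ^ q := by
          conv_lhs => rw [← Real.rpow_one (q * L * d)]
          exact Real.rpow_le_rpow_of_exponent_le hx (by linarith)
        have h2 : ((ρ ^ 2) ^ r) ^ q = (ρ ^ (2 * q)) ^ r := by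
          rw [← Real.rpow_natCast, ← Real.rpow_natCast, ← Real.rpow_natCast, ← Real.rpow_mul hρ0.le,
            ← Real.rpow_mul hρ0.le, ← Real.rpow_mul hρ0.le]
          congr 1
          push_cast
          ring
        rw [Real.mul_rpow (by positivity) (by positivity), h2]
        have h3 : 0 < (ρ ^ (2 * q)) ^ r := by positivity
        calc q * P ≤ q * (L * d * Y * (ρ ^ (2 * q)) ^ r) := by gcongr
          _ = Y * ((q * L * d) * (ρ ^ (2 * q)) ^ r) := by ring
          _ ≤ 6 * Y * ((q * L * d) ^ q * (ρ ^ (2 * q)) ^ r) := by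
            gcongr
            linarith
  · -- bad level
    push Not at hgood
    have key := transfer h G.edgeFinset S (fun j v => nbd G (A j) v r)
      (β * ((1 - ρ) * ρ ^ r) * Y) (6 * Y) (by positivity) hspec ?_
      (fun e j => if e ∈ bdE G (A j) then 1 else 0) ?_
    · refine key.trans ?_
      refine mul_le_mul_of_nonneg_right ?_ hQ0
      have e1 : 6 * Y / (β * ((1 - ρ) * ρ ^ r) * Y) = 6 / (β * (1 - ρ) * ρ ^ r) := by
        field_simp
      rw [e1]
      have h4 : (ρ ^ (2 * q)) ^ r ≤ ρ ^ r * ρ ^ r * ρ ^ r := by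
        have h5 : ρ ^ (2 * q) ≤ ρ ^ (3 : ℝ) :=
          Real.rpow_le_rpow_of_exponent_ge hρ0 hρ1.le (by linarith)
        calc (ρ ^ (2 * q)) ^ r ≤ (ρ ^ (3 : ℝ)) ^ r := by gcongr
          _ = _ := by
            have : ρ ^ (3 : ℝ) = ρ * ρ * ρ := by
              rw [show (3 : ℝ) = ((3 : ℕ) : ℝ) by norm_num, Real.rpow_natCast]; ring
            rw [this, mul_pow, mul_pow]
      have h6 : β * (1 - ρ) ≤ 2 * L * d * (ρ ^ r * ρ ^ r) := by
        have h7 : β * ((1 - ρ) * ρ ^ r) * Y / 2 < L * d * Y * (ρ ^ r * ρ ^ r * ρ ^ r) :=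
          hgood.trans_le (hPle.trans (by gcongr))
        have h8 : 0 < ρ ^ r * Y := by positivity
        refine le_of_mul_le_mul_right ?_ h8
        nlinarith
      rw [div_le_iff₀ (by positivity)]
      have e2 : 12 * C * q * L * d / (β ^ 2 * (1 - ρ) ^ 2) * ρ ^ r * (β * (1 - ρ) * ρ ^ r) =
        6 * C * q * (2 * L * d * (ρ ^ r * ρ ^ r)) / (β * (1 - ρ)) := by
        field_simp
        ring
      rw [e2, le_div_iff₀ (by positivity)]
      have h9 : 1 ≤ C * q := by nlinarith
      have h10 : 0 ≤ 2 * L * d * (ρ ^ r * ρ ^ r) := by positivity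
      have h11 := mul_le_mul_of_nonneg_right h9 h10
      calc 6 * (β * (1 - ρ)) ≤ 6 * (C * q * (2 * L * d * (ρ ^ r * ρ ^ r))) := by linarith
        _ = _ := by ring
    · intro j v e he
      exact (mem_filter.1 (mem_filter.1 he).1).1
    · intro e he
      refine per_edge_trivial h S _ e _ (univ.filter fun v => edgeDist G v e ≤ (r : ℕ∞))
        (6 * Y) (near_card hd G hreg e r) ?_ (hu e)
      intro j v hv hev
      have h1 := mem_filter.1 hev
      exact ⟨by simpa using h1.2, by simp [h1.1]⟩

theorem core {n d : ℕ} {I : Type*} (q C α ε L ρ : ℝ)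
    (hq : 2 ≤ q) (hC : 1 ≤ C) (hd : 3 ≤ d)
    (hα : 0 < α ∧ α ≤ 1) (hε : 0 < ε ∧ ε ≤ 1) (hL : 1 ≤ L) (hρ : 0 < ρ ∧ ρ < 1)
    (hρq : (d : ℝ) - 1 - ε ≤ ρ ^ (2 * q) * ((d : ℝ) - 1))
    (G : SimpleGraph (Fin n)) [DecidableRel G.Adj]
    (hreg : ∀ v, G.degree v = d) (hExp : Expan n d G α ε L)
    (M : (I → ℝ) → ℝ) (h : LatFun M q C) (A : I → Finset (Fin n))
    (hA : ∀ j, ((A j).card : ℝ) ≤ n / 2) :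
    ∑ v, M (fun j => if v ∈ A j then 1 else 0) ≤
      12 * C * q * L * d / ((α / 20) ^ 2 * (1 - ρ) ^ 2) / (1 - ρ) *
        ∑ e ∈ G.edgeFinset, M (fun j => if e ∈ bdE G (A j) then 1 else 0) := by
  have hd' : (3 : ℝ) ≤ d := by exact_mod_cast hd
  obtain ⟨R, hR⟩ := pow_unbounded_of_one_lt (3 * n / 4 / α) (show 1 < (d : ℝ) - 1 by linarith)
  rw [div_lt_iff₀ hα.1] at hR
  have hlt : ∀ j, ∀ v ∈ A j, lev d G α ρ (A j) v < R := by
    intro j v hv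
    by_contra hcon
    push Not at hcon
    have := lemma_one hd G hreg α ρ hα hρ hExp.1 (A j) {v} (hA j) (by simpa using hv) (by simp) R
      (fun u hu i hi => by
        rw [mem_singleton] at hu
        subst hu
        exact lev_small G α ρ (A j) u i (by omega))
    simp at this
    linarith
  have h1 : ∀ v, M (fun j => if v ∈ A j then 1 else 0) ≤ ∑ r ∈ range R,
      M (fun j => if v ∈ (A j).filter (fun v => lev d G α ρ (A j) v = r) then 1 else 0) := by
    intro v
    refine le_trans (le_of_eq ?_) (h.sum_le _ _)
    congr 1
    funext j
    rw [Finset.sum_apply]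
    simp only [mem_filter]
    by_cases hv : v ∈ A j
    · simp only [hv, true_and, if_true]
      rw [Finset.sum_ite_eq, if_pos (by simpa using hlt j v hv)]
    · simp [hv]
  refine (Finset.sum_le_sum fun v _ => h1 v).trans ?_
  rw [Finset.sum_comm]
  refine (Finset.sum_le_sum fun r _ => level_bound q C α ε L ρ hq hC hd hα hε hL hρ hρq G hreg hExp
    M h A hA r).trans ?_
  rw [← Finset.sum_mul, ← Finset.mul_sum]
  refine mul_le_mul_of_nonneg_right ?_ (Finset.sum_nonneg fun e _ => h.nonneg _)
  rw [div_eq_mul_inv _ (1 - ρ)]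
  have hρ' : 0 < 1 - ρ := by linarith [hρ.2]
  have := hα.1
  refine mul_le_mul_of_nonneg_left ?_ (by positivity)
  rw [← one_div, le_div_iff₀ hρ', mul_comm, mul_neg_geom_sum]
  have : 0 < ρ ^ R := pow_pos hρ.1 _
  linarith

/-! ### norms and layer cake -/

theorem N_nonneg {k : ℕ} {N : (Fin k → ℝ) → ℝ} (hN : IsNorm k N) (x : Fin k → ℝ) : 0 ≤ N x := by
  obtain ⟨h0, h1, h2⟩ := hN
  have a := h2 x ((-1 : ℝ) • x)
  rw [h1] at a
  have b : x + (-1 : ℝ) • x = 0 := by simp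
  rw [b, (h0 0).2 rfl] at a
  simp at a
  linarith

theorem N_update {k : ℕ} {N : (Fin k → ℝ) → ℝ} (hN : IsNorm k N) (hunc : OneUnconditional k N)
    (y : Fin k → ℝ) (j : Fin k) (s : ℝ) (hs : |s| ≤ |y j|) : N (Function.update y j s) ≤ N y := by
  have hy : N (Function.update y j (- y j)) = N y := by
    rw [hunc, hunc y]
    congr 1
    funext i
    by_cases hi : i = j
    · subst hi; simp
    · simp [hi]
  set c := s / y j with hc
  have hcs : c * y j = s := by
    by_cases h0 : y j = 0
    · rw [h0] at hs ⊢
      simp at hs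
      simp [hs]
    · rw [hc]; field_simp
  have hc1 : |c| ≤ 1 := by
    rw [hc, abs_div]
    exact div_le_one_of_le₀ hs (abs_nonneg _)
  rw [abs_le] at hc1
  have heq : Function.update y j s =
      ((1 + c) / 2) • y + ((1 - c) / 2) • Function.update y j (- y j) := by
    funext i
    by_cases hi : i = j
    · subst hi
      simp
      rw [← hcs]; ring
    · simp [hi]
      ring
  rw [heq]
  refine (hN.2.2 _ _).trans ?_
  rw [hN.2.1, hN.2.1, hy, abs_of_nonneg (by linarith), abs_of_nonneg (by linarith)]
  apply le_of_eq
  ring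

theorem N_mono {k : ℕ} {N : (Fin k → ℝ) → ℝ} (hN : IsNorm k N) (hunc : OneUnconditional k N)
    (x y : Fin k → ℝ) (hxy : ∀ j, |x j| ≤ |y j|) : N x ≤ N y := by
  have key : ∀ J : Finset (Fin k), N (fun j => if j ∈ J then x j else y j) ≤ N y := by
    intro J
    induction J using Finset.induction_on with
    | empty => simp
    | insert a J ha ih =>
      have heq : (fun j => if j ∈ insert a J then x j else y j) =
          Function.update (fun j => if j ∈ J then x j else y j) a (x a) := by
        funext i
        by_cases hi : i = a
        · subst hi; simp
        · simp [hi]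
      rw [heq]
      refine (N_update hN hunc _ a (x a) ?_).trans ih
      simp [ha, hxy]
  simpa using key univ

theorem N_lower {k : ℕ} {N : (Fin k → ℝ) → ℝ} (hN : IsNorm k N) (hunc : OneUnconditional k N)
    {q C : ℝ} (hq : 2 ≤ q) (hC : 1 ≤ C) (hcot : HasCotype k N q C) (m : ℕ)
    (x : Fin m → Fin k → ℝ) (hx : ∀ i, 0 ≤ x i) :
    ∑ i, N (x i) ^ q ≤ C ^ q * N (∑ i, x i) ^ q := by
  have h1 := hcot m x
  have h2 : ∀ σ : Fin m → Bool, N (∑ i, (if σ i then (1 : ℝ) else -1) • x i) ^ q ≤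
      N (∑ i, x i) ^ q := by
    intro σ
    refine Real.rpow_le_rpow (N_nonneg hN _) (N_mono hN hunc _ _ fun j => ?_) (by linarith)
    rw [Finset.sum_apply, Finset.sum_apply]
    rw [abs_of_nonneg (Finset.sum_nonneg fun i _ => hx i j)]
    refine (Finset.abs_sum_le_sum_abs _ _).trans (Finset.sum_le_sum fun i _ => ?_)
    have := hx i j
    simp only [Pi.smul_apply, smul_eq_mul, abs_mul]
    rw [abs_of_nonneg this]
    split_ifs <;> simp
  have h3 : (1 : ℝ) / 2 ^ m * ∑ σ : Fin m → Bool,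
      N (∑ i, (if σ i then (1 : ℝ) else -1) • x i) ^ q ≤ N (∑ i, x i) ^ q := by
    have := Finset.sum_le_sum fun (σ : Fin m → Bool) (_ : σ ∈ univ) => h2 σ
    rw [Finset.sum_const, Finset.card_univ] at this
    simp only [Fintype.card_pi, Fintype.card_bool, Finset.prod_const, Finset.card_univ,
      Fintype.card_fin, nsmul_eq_mul] at this
    push_cast at this
    rw [one_div, inv_mul_le_iff₀ (by positivity)]
    exact this
  have h4 := h1.trans h3
  have hCq : 0 < C ^ q := Real.rpow_pos_of_pos (by linarith) q
  rwa [one_div, inv_mul_le_iff₀ hCq] at h4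

theorem layer (S : Finset ℝ) (hS : ∀ a ∈ S, 0 < a) : ∃ w : ℝ → ℝ, (∀ t ∈ S, 0 ≤ w t) ∧
    (∀ a ∈ S, ∑ t ∈ S, (if t ≤ a then w t else 0) = a) ∧
    ∀ b, 0 ≤ b → (∀ a ∈ S, a ≤ b) → ∑ t ∈ S, w t ≤ b := by
  induction S using Finset.induction_on_max with
  | empty => exact ⟨fun _ => 0, by simp, by simp, by simp⟩
  | insert b S hb ih =>
    obtain ⟨w, h1, h2, h3⟩ := ih fun a ha => hS a (mem_insert_of_mem ha)
    have hbS : b ∉ S := fun h => lt_irrefl _ (hb b h)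
    have hb0 : 0 < b := hS b (mem_insert_self _ _)
    have hne : ∀ t ∈ S, t ≠ b := fun t ht => (hb t ht).ne
    have hsum : ∑ t ∈ S, Function.update w b (b - ∑ t ∈ S, w t) t = ∑ t ∈ S, w t :=
      Finset.sum_congr rfl fun t ht => by rw [Function.update_of_ne (hne t ht)]
    refine ⟨Function.update w b (b - ∑ t ∈ S, w t), ?_, ?_, ?_⟩
    · intro t ht
      rcases mem_insert.1 ht with rfl | ht
      · rw [Function.update_self]
        have := h3 t hb0.le fun a ha => (hb a ha).le
        linarith
      · rw [Function.update_of_ne (hne t ht)]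
        exact h1 t ht
    · intro a ha
      rw [Finset.sum_insert hbS]
      rcases mem_insert.1 ha with rfl | ha
      · rw [if_pos le_rfl, Function.update_self]
        have : ∑ t ∈ S, (if t ≤ a then Function.update w a (a - ∑ t ∈ S, w t) t else 0) =
            ∑ t ∈ S, w t := by
          refine Eq.trans ?_ hsum
          exact Finset.sum_congr rfl fun t ht => by rw [if_pos (hb t ht).le]
        rw [this]
        ring
      · rw [if_neg (not_le.2 (hb a ha)), zero_add]
        conv_rhs => rw [← h2 a ha]
        exact Finset.sum_congr rfl fun t ht => by rw [Function.update_of_ne (hne t ht)]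
    · intro c hc hca
      rw [Finset.sum_insert hbS, Function.update_self, hsum]
      have := hca b (mem_insert_self _ _)
      linarith

theorem layer_pos (S : Finset ℝ) (hS : ∀ a ∈ S, 0 < a) (w : ℝ → ℝ)
    (hw : ∀ a ∈ S, ∑ t ∈ S, (if t ≤ a then w t else 0) = a) (a : ℝ) (ha : a ∈ S ∨ a ≤ 0) :
    ∑ t ∈ S, w t * (if 0 < t ∧ t ≤ a then 1 else 0) = max a 0 := by
  have h1 : ∑ t ∈ S, w t * (if 0 < t ∧ t ≤ a then 1 else 0) =
      ∑ t ∈ S, (if t ≤ a then w t else 0) :=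
    Finset.sum_congr rfl fun t ht => by simp [hS t ht]
  rw [h1]
  rcases ha with ha | ha
  · rw [hw a ha, max_eq_left (hS a ha).le]
  · rw [max_eq_right ha]
    exact Finset.sum_eq_zero fun t ht => if_neg (by have := hS t ht; linarith)

theorem layer_diff (S : Finset ℝ) (hS : ∀ a ∈ S, 0 < a) (w : ℝ → ℝ)
    (hw : ∀ a ∈ S, ∑ t ∈ S, (if t ≤ a then w t else 0) = a) (a b : ℝ) (ha : a ∈ S ∨ a ≤ 0)
    (hb : b ∈ S ∨ b ≤ 0) :
    ∑ t ∈ S, w t * (if ¬ ((0 < t ∧ t ≤ a) ↔ (0 < t ∧ t ≤ b)) then 1 else 0) =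
      |max a 0 - max b 0| := by
  wlog hab : a ≤ b generalizing a b
  · have := this b a hb ha (not_le.1 hab).le
    rw [abs_sub_comm, ← this]
    refine Finset.sum_congr rfl fun t _ => ?_
    congr 2
    rw [iff_comm]
  rw [abs_sub_comm, abs_of_nonneg (sub_nonneg.2 (max_le_max_right 0 hab)),
    ← layer_pos S hS w hw a ha, ← layer_pos S hS w hw b hb, ← Finset.sum_sub_distrib]
  refine Finset.sum_congr rfl fun t ht => ?_
  rw [← mul_sub]
  congr 1
  have h0 := hS t ht
  by_cases h1 : t ≤ a
  · have h2 : t ≤ b := h1.trans hab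
    simp [h0, h1, h2]
  · by_cases h2 : t ≤ b
    · simp [h0, h1, h2]
    · simp [h0, h1, h2]

theorem bdE_iff {n : ℕ} (G : SimpleGraph (Fin n)) [DecidableRel G.Adj] (A : Finset (Fin n))
    (a b : Fin n) (hab : s(a, b) ∈ G.edgeFinset) :
    s(a, b) ∈ bdE G A ↔ ¬ (a ∈ A ↔ b ∈ A) := by
  simp only [bdE, mem_filter, hab, true_and]
  constructor
  · rintro ⟨x, y, hxy, hx, hy⟩
    rcases Sym2.eq_iff.1 hxy with ⟨rfl, rfl⟩ | ⟨rfl, rfl⟩ <;> tauto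
  · intro h
    by_cases ha : a ∈ A
    · exact ⟨a, b, rfl, ha, by tauto⟩
    · exact ⟨b, a, Sym2.eq_swap, by tauto, ha⟩

theorem max_abs_aux (x y : ℝ) :
    |max x 0 - max y 0| + |max (-x) 0 - max (-y) 0| = |x - y| := by
  rcases le_total x 0 with hx | hx <;> rcases le_total y 0 with hy | hy
  · rw [max_eq_right hx, max_eq_right hy, max_eq_left (by linarith), max_eq_left (by linarith)]
    rw [sub_self, abs_zero, zero_add, ← abs_neg]; congr 1; ring
  · rw [max_eq_right hx, max_eq_left hy, max_eq_left (by linarith), max_eq_right (by linarith)]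
    rw [abs_of_nonpos (by linarith), abs_of_nonneg (by linarith), abs_of_nonpos (by linarith)]
    ring
  · rw [max_eq_left hx, max_eq_right hy, max_eq_right (by linarith), max_eq_left (by linarith)]
    rw [abs_of_nonneg (by linarith), abs_of_nonpos (by linarith), abs_of_nonneg (by linarith)]
    ring
  · rw [max_eq_left hx, max_eq_left hy, max_eq_right (by linarith), max_eq_right (by linarith)]
    simp

theorem const_bound (q C α ε L d : ℝ)
    (hq : 2 ≤ q) (hC : 1 ≤ C) (hd : 3 ≤ d)
    (hα : 0 < α ∧ α ≤ 1) (hε : 0 < ε ∧ ε ≤ 1) (hL : 1 ≤ L) :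
    12 * C * q * L * d / ((α / 20) ^ 2 * (ε / (2 * q * d)) ^ 2) / (ε / (2 * q * d)) ≤
      3 * (2 ^ 113 * q ^ 10 * C ^ 2 * (d ^ 24 * L ^ 8 / (α ^ 14 * ε ^ 18))) / 2 := by
  obtain ⟨hα0, hα1⟩ := hα
  obtain ⟨hε0, hε1⟩ := hε
  have e1 : 12 * C * q * L * d / ((α / 20) ^ 2 * (ε / (2 * q * d)) ^ 2) / (ε / (2 * q * d)) =
      38400 * q ^ 4 * C * (d ^ 4 * L / (α ^ 2 * ε ^ 3)) := by
    field_simp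
    ring
  have e2 : 3 * (2 ^ 113 * q ^ 10 * C ^ 2 * (d ^ 24 * L ^ 8 / (α ^ 14 * ε ^ 18))) / 2 =
      (3 * 2 ^ 112) * q ^ 10 * C ^ 2 * (d ^ 24 * L ^ 8 / (α ^ 14 * ε ^ 18)) := by ring
  rw [e1, e2]
  have hq4 : q ^ 4 ≤ q ^ 10 := pow_le_pow_right₀ (by linarith) (by norm_num)
  have hC2 : C ≤ C ^ 2 := by nlinarith
  have hd4 : d ^ 4 ≤ d ^ 24 := pow_le_pow_right₀ (by linarith) (by norm_num)
  have hL8 : L ≤ L ^ 8 := le_self_pow₀ hL (by norm_num)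
  have ha : α ^ 14 ≤ α ^ 2 := pow_le_pow_of_le_one hα0.le hα1 (by norm_num)
  have he : ε ^ 18 ≤ ε ^ 3 := pow_le_pow_of_le_one hε0.le hε1 (by norm_num)
  have hdd : (0 : ℝ) < d := by linarith
  have hqq : (0 : ℝ) < q := by linarith
  gcongr
  norm_num

/-- Corollary 3.3, inequality (3.4): the `L¹` Poincaré-type inequality for maps having `0` as
an empirical median. -/
theorem stmt_5 {n d k : ℕ} (q C α ε L : ℝ)
    (hq : 2 ≤ q) (hC : 1 ≤ C) (hd : 3 ≤ d)
    (hα : 0 < α ∧ α ≤ 1) (hε : 0 < ε ∧ ε ≤ 1) (hL : 1 ≤ L)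
    (G : SimpleGraph (Fin n)) [DecidableRel G.Adj]
    (hreg : ∀ v, G.degree v = d)
    (hExp : Expan n d G α ε L)
    (hk : 1 ≤ k) (N : (Fin k → ℝ) → ℝ)
    (hN : IsNorm k N) (hunc : OneUnconditional k N) (hcot : HasCotype k N q C)
    (f : Fin n → Fin k → ℝ)
    (hnc : ∃ v w, f v ≠ f w)
    (hmed : ∀ j, (n : ℝ) / 2 ≤
      min ((univ.filter fun v => 0 ≤ f v j).card : ℝ)
        ((univ.filter fun v => f v j ≤ 0).card : ℝ)) :
    ∑ v, N (f v) ≤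
      3 * (2 ^ 113 * q ^ 10 * C ^ 2 * ((d : ℝ) ^ 24 * L ^ 8 / (α ^ 14 * ε ^ 18))) / 2 *
        ∑ e ∈ G.edgeFinset, edgeNorm N f e := by

  have hd' : (3 : ℝ) ≤ d := by exact_mod_cast hd
  set S : Finset ℝ := ((univ : Finset (Fin n × Fin k)).image fun p => |f p.1 p.2|).filter
    fun t => 0 < t with hSdef
  have hS : ∀ a ∈ S, 0 < a := fun a ha => (mem_filter.1 ha).2
  have hfS : ∀ v j, f v j ∈ S ∨ f v j ≤ 0 := by
    intro v j
    by_cases h : f v j ≤ 0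
    · exact Or.inr h
    · push Not at h
      left
      refine mem_filter.2 ⟨mem_image.2 ⟨(v, j), mem_univ _, abs_of_pos h⟩, h⟩
  have hfS' : ∀ v j, -f v j ∈ S ∨ -f v j ≤ 0 := by
    intro v j
    by_cases h : -f v j ≤ 0
    · exact Or.inr h
    · push Not at h
      left
      refine mem_filter.2 ⟨mem_image.2 ⟨(v, j), mem_univ _, abs_of_neg (by linarith)⟩, h⟩
  obtain ⟨w, hw0, hw, -⟩ := layer S hS
  set Φ : (Fin k × ℝ × Bool → ℝ) → Fin k → ℝ := fun y j =>
    ∑ t ∈ S, w t * (y (j, t, true) + y (j, t, false)) with hΦ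
  have hΦmono : ∀ x y, x ≤ y → Φ x ≤ Φ y := by
    intro x y hxy j
    refine Finset.sum_le_sum fun t ht => mul_le_mul_of_nonneg_left ?_ (hw0 t ht)
    exact add_le_add (hxy _) (hxy _)
  have hΦ0 : Φ 0 = 0 := by funext j; simp [hΦ]
  have hΦadd : ∀ x y, Φ (x + y) = Φ x + Φ y := by
    intro x y
    funext j
    simp only [hΦ, Pi.add_apply]
    rw [← Finset.sum_add_distrib]
    exact Finset.sum_congr rfl fun t _ => by ring
  have hΦsmul : ∀ (c : ℝ) x, Φ (c • x) = c • Φ x := by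
    intro c x
    funext j
    simp only [hΦ, Pi.smul_apply, smul_eq_mul]
    rw [Finset.mul_sum]
    exact Finset.sum_congr rfl fun t _ => by ring
  have hΦsum : ∀ (m : ℕ) (x : Fin m → Fin k × ℝ × Bool → ℝ), Φ (∑ i, x i) = ∑ i, Φ (x i) := by
    intro m x
    have : ∀ s : Finset (Fin m), Φ (∑ i ∈ s, x i) = ∑ i ∈ s, Φ (x i) := by
      intro s
      induction s using Finset.induction_on with
      | empty => simp [hΦ0]
      | insert a s ha ih => rw [Finset.sum_insert ha, Finset.sum_insert ha, hΦadd, ih]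
    exact this univ
  have hM : LatFun (fun y => N (Φ y)) q C := by
    refine ⟨fun x => N_nonneg hN _, ?_, ?_, ?_, ?_⟩
    · intro x y hx hxy
      refine N_mono hN hunc _ _ fun j => ?_
      have h1 := hΦmono _ _ hx j
      have h2 := hΦmono _ _ hxy j
      rw [hΦ0] at h1
      simp only [Pi.zero_apply] at h1
      rw [abs_of_nonneg h1, abs_of_nonneg (h1.trans h2)]
      exact h2
    · intro c x hc
      rw [hΦsmul, hN.2.1, abs_of_nonneg hc]
    · intro x y
      rw [hΦadd]
      exact hN.2.2 _ _
    · intro m x hx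
      rw [hΦsum]
      refine N_lower hN hunc hq hC hcot m _ fun i => ?_
      have := hΦmono _ _ (hx i)
      rwa [hΦ0] at this
  set A : Fin k × ℝ × Bool → Finset (Fin n) := fun i =>
    univ.filter fun v => 0 < i.2.1 ∧ i.2.1 ≤ (if i.2.2 then f v i.1 else -f v i.1) with hAdef
  have hA : ∀ i, ((A i).card : ℝ) ≤ n / 2 := by
    rintro ⟨j, t, b⟩
    have hm := hmed j
    rw [le_min_iff] at hm
    have hcompl : ∀ B : Finset (Fin n), Disjoint (A (j, t, b)) B → (n : ℝ) / 2 ≤ B.card →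
        ((A (j, t, b)).card : ℝ) ≤ n / 2 := by
      intro B hB hBc
      have h1 := Finset.card_le_univ (A (j, t, b) ∪ B)
      rw [Finset.card_union_of_disjoint hB, Fintype.card_fin] at h1
      have h2 : ((A (j, t, b)).card : ℝ) + B.card ≤ n := by exact_mod_cast h1
      linarith
    cases b
    · refine hcompl _ ?_ hm.1
      rw [Finset.disjoint_left]
      intro v hv hv'
      simp only [hAdef, mem_filter, mem_univ, true_and] at hv hv'
      simp at hv
      linarith
    · refine hcompl _ ?_ hm.2
      rw [Finset.disjoint_left]
      intro v hv hv'
      simp only [hAdef, mem_filter, mem_univ, true_and] at hv hv'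
      simp at hv
      linarith
  have hρval : 0 < ε / (2 * q * d) ∧ ε / (2 * q * d) < 1 := by
    have := hε.1
    refine ⟨by positivity, ?_⟩
    rw [div_lt_one (by positivity)]
    nlinarith [hε.2]
  have hρq : (d : ℝ) - 1 - ε ≤ (1 - ε / (2 * q * d)) ^ (2 * q) * ((d : ℝ) - 1) := by
    have h1 := one_add_mul_self_le_rpow_one_add (s := -(ε / (2 * q * d))) (by linarith)
      (p := 2 * q) (by linarith)
    have h2 : 1 + 2 * q * -(ε / (2 * q * d)) = 1 - ε / d := by field_simp; ring
    rw [h2, ← sub_eq_add_neg] at h1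
    refine le_trans ?_ (mul_le_mul_of_nonneg_right h1 (by linarith))
    have h3 : (1 - ε / d) * ((d : ℝ) - 1) = d - 1 - ε + ε / d := by field_simp; ring
    rw [h3]
    have := hε.1
    have : 0 < ε / d := by positivity
    linarith
  have key := core q C α ε L (1 - ε / (2 * q * d)) hq hC hd hα hε hL
    ⟨by linarith, by linarith⟩ hρq G hreg hExp _ hM A hA
  have hv : ∀ v, N (Φ fun i => if v ∈ A i then 1 else 0) = N (f v) := by
    intro v
    rw [hunc (f v)]
    congr 1
    funext j
    simp only [hΦ, hAdef, mem_filter, mem_univ, true_and, if_true, Bool.false_eq_true, if_false]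
    simp only [mul_add]
    rw [Finset.sum_add_distrib]
    have h1 := layer_pos S hS w hw (f v j) (hfS v j)
    have h2 := layer_pos S hS w hw (-f v j) (hfS' v j)
    have h3 := max_abs_aux (f v j) 0
    simp only [max_self, sub_zero, neg_zero] at h3
    rw [abs_of_nonneg (le_max_right _ _), abs_of_nonneg (le_max_right _ _)] at h3
    rw [← h3, ← h1, ← h2]
  have he : ∀ e ∈ G.edgeFinset, N (Φ fun i => if e ∈ bdE G (A i) then 1 else 0) =
      edgeNorm N f e := by
    intro e he
    induction e with
    | h a b =>
      have hsym : N (f b - f a) = N (f a - f b) := by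
        rw [hunc, hunc (f a - f b)]
        congr 1
        funext j
        exact abs_sub_comm _ _
      simp only [edgeNorm, Sym2.lift_mk]
      rw [hsym, min_self, hunc (f a - f b)]
      congr 1
      funext j
      simp only [hΦ, bdE_iff G _ a b he]
      simp only [hAdef, mem_filter, mem_univ, true_and, if_true, Bool.false_eq_true, if_false]
      simp only [mul_add]
      rw [Finset.sum_add_distrib]
      have h1 := layer_diff S hS w hw (f a j) (f b j) (hfS a j) (hfS b j)
      have h2 := layer_diff S hS w hw (-f a j) (-f b j) (hfS' a j) (hfS' b j)
      rw [Pi.sub_apply, ← max_abs_aux (f a j) (f b j), ← h1, ← h2]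
  simp only [hv] at key
  rw [Finset.sum_congr rfl he] at key
  refine key.trans ?_
  refine mul_le_mul_of_nonneg_right ?_ (Finset.sum_nonneg fun e hee => ?_)
  · rw [sub_sub_cancel]
    exact const_bound q C α ε L d hq hC hd' hα hε hL
  · rw [← he e hee]
    exact N_nonneg hN _
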